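/- If θ₁, θ₂, θ₃ ∈ (0,π) and θ₁+θ₂+θ₃ = π, then Λ(θ₁)+Λ(θ₂)+Λ(θ₃) > 0. Moreover, if θ₁, θ₂, θ₃ ∈ [0,π] and θ₁+θ₂+θ₃ = π, then Λ(θ₁)+Λ(θ₂)+Λ(θ₃) ≥ 0. -/

import Mathlib

open Real

/-- The Lobachevsky function `Λ(x) = -∫₀ˣ log |2 sin t| dt`. -/
noncomputable def lob (x : ℝ) : ℝ := -∫ t in (0:ℝ)..x, Real.log |2 * Real.sin t|

theorem log_abs_two_mul_sin_ae_eq :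
    (fun t : ℝ => Real.log |2 * Real.sin t|) =ᵐ[MeasureTheory.volume]
      fun t => Real.log 2 + Real.log (Real.sin t) := by
  have hc : {t : ℝ | Real.sin t = 0}.Countable := by
    have h : {t : ℝ | Real.sin t = 0} = Set.range fun n : ℤ => (n : ℝ) * π := by
      ext t
      simp [Real.sin_eq_zero_iff]
    rw [h]
    exact Set.countable_range _
  filter_upwards [hc.ae_notMem MeasureTheory.volume] with t ht
  rw [Real.log_abs, Real.log_mul two_ne_zero ht]

theorem intervalIntegrable_log_abs_two_mul_sin (a b : ℝ) :
    IntervalIntegrable (fun t => Real.log |2 * Real.sin t|) MeasureTheory.volume a b := by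
  have h : IntervalIntegrable (fun t => Real.log 2 + Real.log (Real.sin t))
      MeasureTheory.volume a b :=
    intervalIntegrable_const.add intervalIntegrable_log_sin
  exact h.congr_ae (MeasureTheory.ae_restrict_of_ae log_abs_two_mul_sin_ae_eq.symm)

theorem intervalIntegrable_log_abs_two_mul_sin_add (a b : ℝ) :
    IntervalIntegrable (fun t => Real.log |2 * Real.sin (t + b)|) MeasureTheory.volume 0 a := by
  simpa using (intervalIntegrable_log_abs_two_mul_sin b (a + b)).comp_add_right b

theorem lob_pi : lob π = 0 := by
  have hi : IntervalIntegrable (fun t => Real.log (Real.sin t)) MeasureTheory.volume 0 π :=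
    intervalIntegrable_log_sin
  rw [lob, intervalIntegral.integral_congr_ae (g := fun t => Real.log 2 + Real.log (Real.sin t))
      (log_abs_two_mul_sin_ae_eq.mono fun t ht _ => ht),
    intervalIntegral.integral_add intervalIntegrable_const hi,
    integral_log_sin_zero_pi, intervalIntegral.integral_const, smul_eq_mul]
  ring

theorem lob_sub_lob (a b : ℝ) :
    lob a - lob b = ∫ t in a..b, Real.log |2 * Real.sin t| := by
  rw [← intervalIntegral.integral_interval_sub_left
    (intervalIntegrable_log_abs_two_mul_sin 0 b) (intervalIntegrable_log_abs_two_mul_sin 0 a)]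
  simp only [lob]
  ring

theorem lob_pi_sub (x : ℝ) : lob (π - x) = -lob x := by
  have h := lob_sub_lob (π - x) π
  have h' := intervalIntegral.integral_comp_sub_left
    (fun t => Real.log |2 * Real.sin t|) (a := 0) (b := x) π
  simp only [Real.sin_pi_sub, sub_zero] at h'
  rw [← h', lob_pi] at h
  simp only [lob] at h ⊢
  linarith

theorem lob_add_add_eq_integral {a b c : ℝ} (h : a + b + c = π) :
    lob a + lob b + lob c =
      ∫ t in (0:ℝ)..a, (Real.log |2 * Real.sin (t + b)| - Real.log |2 * Real.sin t|) := by
  rw [intervalIntegral.integral_sub (intervalIntegrable_log_abs_two_mul_sin_add a b)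
      (intervalIntegrable_log_abs_two_mul_sin 0 a),
    intervalIntegral.integral_comp_add_right (fun t => Real.log |2 * Real.sin t|), zero_add,
    ← lob_sub_lob, show c = π - (a + b) by linarith, lob_pi_sub]
  simp only [lob]
  ring

theorem sin_lt_sin_add {b t : ℝ} (ht : 0 < t) (hb : 0 < b) (h : 2 * t + b < π) :
    Real.sin t < Real.sin (t + b) := by
  have hs : 0 < Real.sin (b / 2) := Real.sin_pos_of_pos_of_lt_pi (by linarith) (by linarith)
  have hc : 0 < Real.cos (t + b / 2) :=
    Real.cos_pos_of_mem_Ioo ⟨by linarith [Real.pi_pos], by linarith⟩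
  have e := Real.sin_sub_sin (t + b) t
  rw [show (t + b - t) / 2 = b / 2 by ring, show (t + b + t) / 2 = t + b / 2 by ring] at e
  nlinarith [mul_pos hs hc]

theorem lob_add_add_pos_of_le {a b c : ℝ} (ha : 0 < a) (hb : 0 < b) (hac : a ≤ c)
    (h : a + b + c = π) : 0 < lob a + lob b + lob c := by
  rw [lob_add_add_eq_integral h]
  refine intervalIntegral.intervalIntegral_pos_of_pos_on
    ((intervalIntegrable_log_abs_two_mul_sin_add a b).sub
      (intervalIntegrable_log_abs_two_mul_sin 0 a)) (fun t ht => ?_) ha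
  have hs : 0 < Real.sin t := Real.sin_pos_of_pos_of_lt_pi ht.1 (by linarith [ht.2])
  have hlt := sin_lt_sin_add ht.1 hb (by linarith [ht.2])
  rw [sub_pos, Real.log_abs, Real.log_abs]
  exact Real.log_lt_log (by linarith) (by linarith)

theorem lob_add_add_pos {a b c : ℝ} (ha : 0 < a) (hb : 0 < b) (hc : 0 < c)
    (h : a + b + c = π) : 0 < lob a + lob b + lob c := by
  rcases le_total a c with hac | hca
  · exact lob_add_add_pos_of_le ha hb hac h
  · have := lob_add_add_pos_of_le hc hb hca (by linarith)
    linarith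

theorem lob_zero : lob 0 = 0 := by simp [lob]

theorem lob_add_eq_zero {a b : ℝ} (h : a + b = π) : lob a + lob b = 0 := by
  rw [show b = π - a by linarith, lob_pi_sub]
  ring

/-- The volume `Λ(θ₁)+Λ(θ₂)+Λ(θ₃)` of an ideal tetrahedron with angles summing to `π` is
positive when all angles lie in `(0,π)`, and nonnegative when they lie in `[0,π]`. -/
theorem tetrahedron_volume_pos_and_nonneg :
    (∀ θ₁ θ₂ θ₃ : ℝ, θ₁ ∈ Set.Ioo 0 π → θ₂ ∈ Set.Ioo 0 π → θ₃ ∈ Set.Ioo 0 π →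
      θ₁ + θ₂ + θ₃ = π → 0 < lob θ₁ + lob θ₂ + lob θ₃) ∧
    (∀ θ₁ θ₂ θ₃ : ℝ, θ₁ ∈ Set.Icc 0 π → θ₂ ∈ Set.Icc 0 π → θ₃ ∈ Set.Icc 0 π →
      θ₁ + θ₂ + θ₃ = π → 0 ≤ lob θ₁ + lob θ₂ + lob θ₃) := by
  refine ⟨fun a b c ha hb hc h => lob_add_add_pos ha.1 hb.1 hc.1 h, fun a b c ha hb hc h => ?_⟩
  rcases ha.1.eq_or_lt with rfl | ha'
  · linarith [lob_zero, lob_add_eq_zero (a := b) (b := c) (by linarith)]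
  rcases hb.1.eq_or_lt with rfl | hb'
  · linarith [lob_zero, lob_add_eq_zero (a := a) (b := c) (by linarith)]
  rcases hc.1.eq_or_lt with rfl | hc'
  · linarith [lob_zero, lob_add_eq_zero (a := a) (b := b) (by linarith)]
  exact (lob_add_add_pos ha' hb' hc' h).le
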